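/- arXiv:math/9702233 — 2 statements merged into one kernel-verified Lean document; each statement's English description precedes it below -/
import Mathlib

section
/- Let G be a finite group, p a prime, and N a normal subgroup of G having an abelian normal p-complement. Let χ ∈ Irr(G|N) be chosen so that the p-part of χ(1) is as small as possible among degrees of members of Irr(G|N). Then N' ⊆ ker χ. In particular, if N is nontrivial, then cd(G|N') is a proper subset of cd(G|N). -/
open CategoryTheory

/-- `cdOver G N` is `cd(G|N)`: the set of degrees `χ(1)` of irreducible complex characters
`χ` of `G` whose kernel does not contain `N`. -/
def cdOver (G : Type) [Group G] (N : Subgroup G) : Set ℕ :=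
  { d | ∃ V : FDRep ℂ G, Simple V ∧ (¬ ∀ n ∈ N, V.character n = V.character 1) ∧
        d = Module.finrank ℂ V }

/-- If `q` does not divide the sum over an invariant finite set of an invariant function `d`, then
it does not divide the sum of `d` over some orbit. -/
theorem MulAction.exists_not_dvd_index_stabilizer_mul {S X : Type*} [Group S]
    [MulAction S X] (s : Finset X) (hs : ∀ (g : S), ∀ x ∈ s, g • x ∈ s) (d : X → ℕ)
    (hd : ∀ (g : S) (x : X), d (g • x) = d x) {q : ℕ} (h : ¬ q ∣ ∑ x ∈ s, d x) :
    ∃ x ∈ s, ¬ q ∣ (MulAction.stabilizer S x).index * d x := by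
  classical
  by_contra! hc
  refine h ?_
  rw [Finset.sum_partition (MulAction.orbitRel S X)]
  refine Finset.dvd_sum fun y hy => ?_
  obtain ⟨x, hx, rfl⟩ := Finset.mem_image.1 hy
  have horb : ((s.filter fun y => Quotient.mk (MulAction.orbitRel S X) y =
      Quotient.mk (MulAction.orbitRel S X) x : Finset X) : Set X) = MulAction.orbit S x := by
    ext y
    simp only [Finset.coe_filter, Set.mem_ofPred_eq, Quotient.eq, MulAction.orbitRel_apply]
    refine ⟨fun hy => hy.2, fun hy => ⟨?_, hy⟩⟩
    obtain ⟨g, rfl⟩ := hy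
    exact hs g x hx
  have hsum : ∑ y ∈ s with Quotient.mk (MulAction.orbitRel S X) y =
      Quotient.mk (MulAction.orbitRel S X) x, d y = (MulAction.stabilizer S x).index * d x := by
    rw [Finset.sum_const_nat (m := d x), ← Set.ncard_coe_finset, horb, MulAction.index_stabilizer]
    intro y hy
    have : y ∈ MulAction.orbit S x := horb ▸ Finset.mem_coe.2 hy
    obtain ⟨g, rfl⟩ := this
    exact hd g x
  exact hsum ▸ hc x hx

namespace Representation

variable {S V : Type*} [Group S] [AddCommGroup V] [Module ℂ V] (ρ : Representation ℂ S V)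

/-- A group acts on the subspaces of any of its representations. -/
abbrev submoduleMulAction : MulAction S (Submodule ℂ V) where
  smul g W := W.map (ρ g)
  one_smul W := by
    change W.map (ρ 1) = W
    rw [map_one]
    exact Submodule.map_id W
  mul_smul g h W := by
    change W.map (ρ (g * h)) = (W.map (ρ h)).map (ρ g)
    rw [map_mul, Module.End.mul_eq_comp, Submodule.map_comp]

theorem finrank_map_apply (g : S) (W : Submodule ℂ V) :
    Module.finrank ℂ (W.map (ρ g)) = Module.finrank ℂ W :=
  (Submodule.equivMapOfInjective _ (ρ.apply_bijective g).1 W).finrank_eq.symm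

/-- The simultaneous eigenspace of the elements of `B` with eigenvalues `χ`. -/
def weightSpace (B : Subgroup S) (χ : B → ℂ) : Submodule ℂ V :=
  ⨅ b : B, Module.End.eigenspace (ρ b) (χ b)

variable {ρ} in
theorem mem_weightSpace {B : Subgroup S} {χ : B → ℂ} {v : V} :
    v ∈ ρ.weightSpace B χ ↔ ∀ b : B, ρ b v = χ b • v := by
  simp [weightSpace, Submodule.mem_iInf]

theorem apply_mem_weightSpace {B : Subgroup S} [hB : B.Normal] (χ : B → ℂ) (g : S) {v : V}
    (hv : v ∈ ρ.weightSpace B χ) :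
    ρ g v ∈ ρ.weightSpace B fun b => χ ⟨g⁻¹ * b * g, by simpa using hB.conj_mem b b.2 g⁻¹⟩ := by
  rw [mem_weightSpace] at hv ⊢
  intro b
  have := hv ⟨g⁻¹ * b * g, by simpa using hB.conj_mem b b.2 g⁻¹⟩
  rw [← map_smul, ← this, ← Module.End.mul_apply, ← Module.End.mul_apply, ← map_mul, ← map_mul]
  simp [mul_assoc]

theorem map_weightSpace {B : Subgroup S} [hB : B.Normal] (χ : B → ℂ) (g : S) :
    (ρ.weightSpace B χ).map (ρ g) =
      ρ.weightSpace B fun b => χ ⟨g⁻¹ * b * g, by simpa using hB.conj_mem b b.2 g⁻¹⟩ := by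
  refine le_antisymm (Submodule.map_le_iff_le_comap.2 fun v hv => ρ.apply_mem_weightSpace χ g hv)
    fun v hv => ⟨ρ g⁻¹ v, ?_, by rw [← Module.End.mul_apply, ← map_mul]; simp⟩
  have := ρ.apply_mem_weightSpace _ g⁻¹ hv
  simpa [mul_assoc] using this

theorem isSemisimple_apply [Finite S] (g : S) : Module.End.IsSemisimple (ρ g) := by
  refine Module.End.isSemisimple_of_squarefree_aeval_eq_zero
    (K := ℂ)
    (p := Polynomial.X ^ orderOf g - Polynomial.C 1) ?_ ?_
  · refine (Polynomial.separable_X_pow_sub_C 1 ?_ one_ne_zero).squarefree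
    exact_mod_cast (orderOf_pos g).ne'
  · rw [map_sub, map_pow, Polynomial.aeval_X, ← map_pow ρ, pow_orderOf_eq_one]; simp

theorem weightSpace_eq_iInf_maxGenEigenspace [Finite S] [FiniteDimensional ℂ V] (B : Subgroup S)
    (χ : B → ℂ) : ρ.weightSpace B χ = ⨅ b : B, Module.End.maxGenEigenspace (ρ b) (χ b) := by
  simp only [weightSpace, fun b : B =>
    (ρ.isSemisimple_apply (b : S)).isFinitelySemisimple.maxGenEigenspace_eq_eigenspace]

theorem iSup_weightSpace [Finite S] [FiniteDimensional ℂ V] (B : Subgroup S)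
    (hcomm : ∀ a ∈ B, ∀ b ∈ B, Commute (ρ a) (ρ b)) : ⨆ χ, ρ.weightSpace B χ = ⊤ := by
  simp only [weightSpace_eq_iInf_maxGenEigenspace]
  exact Module.End.iSup_iInf_maxGenEigenspace_eq_top_of_iSup_maxGenEigenspace_eq_top_of_commute
    (fun b : B => ρ b) (fun a b _ => hcomm a a.2 b b.2)
    (fun b => Module.End.iSup_maxGenEigenspace_eq_top _)

theorem iSupIndep_weightSpace [Finite S] [FiniteDimensional ℂ V] (B : Subgroup S)
    (hcomm : ∀ a ∈ B, ∀ b ∈ B, Commute (ρ a) (ρ b)) : iSupIndep (ρ.weightSpace B) := by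
  have := Module.End.independent_iInf_maxGenEigenspace_of_forall_mapsTo (fun b : B => ρ b)
    (fun a b φ => Module.End.mapsTo_maxGenEigenspace_of_comm (hcomm b b.2 a a.2) φ)
  simpa only [← weightSpace_eq_iInf_maxGenEigenspace] using this

/-- If the normal subgroup `B` acts by commuting operators and `q` does not divide the dimension,
then some weight space of `B` has `q` not dividing the sum of the dimensions of its conjugates. -/
theorem exists_weightSpace_not_dvd [Finite S] [FiniteDimensional ℂ V] (B : Subgroup S) [B.Normal]
    (hcomm : ∀ a ∈ B, ∀ b ∈ B, Commute (ρ a) (ρ b)) {q : ℕ} (hq : ¬ q ∣ Module.finrank ℂ V) :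
    ∃ (χ : B → ℂ) (T : Subgroup S), B ≤ T ∧
      (∀ g ∈ T, ∀ v ∈ ρ.weightSpace B χ, ρ g v ∈ ρ.weightSpace B χ) ∧
      ¬ q ∣ T.index * Module.finrank ℂ (ρ.weightSpace B χ) := by
  classical
  have hind := ρ.iSupIndep_weightSpace B hcomm
  have hfin : {χ | ρ.weightSpace B χ ≠ ⊥}.Finite := WellFoundedGT.finite_ne_bot_of_iSupIndep hind
  have hint : DirectSum.IsInternal fun χ : {χ | ρ.weightSpace B χ ≠ ⊥} => ρ.weightSpace B χ :=
    DirectSum.isInternal_ne_bot_iff.2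
      (DirectSum.isInternal_submodule_of_iSupIndep_of_iSup_eq_top hind
        (ρ.iSup_weightSpace B hcomm))
  obtain ⟨X, hX, hdim⟩ : ∃ X : Finset (Submodule ℂ V),
      (∀ W, W ∈ X ↔ W ≠ ⊥ ∧ ∃ χ, ρ.weightSpace B χ = W) ∧
        Module.finrank ℂ V = ∑ W ∈ X, Module.finrank ℂ W := by
    refine ⟨hfin.toFinset.image (ρ.weightSpace B), fun W => ?_, ?_⟩
    · rw [Finset.mem_image]
      constructor
      · rintro ⟨χ, hχ, rfl⟩
        exact ⟨hfin.mem_toFinset.1 hχ, χ, rfl⟩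
      · rintro ⟨hW, χ, rfl⟩
        exact ⟨χ, hfin.mem_toFinset.2 hW, rfl⟩
    · have := hfin.fintype
      rw [Finset.sum_image fun x hx y hy h =>
        hind.injOn (hfin.mem_toFinset.1 hx) (hfin.mem_toFinset.1 hy) h,
        Finset.sum_subtype (F := this) hfin.toFinset fun χ => hfin.mem_toFinset]
      exact (LinearEquiv.ofBijective (DirectSum.coeLinearMap _) hint).finrank_eq.symm.trans
        (Module.finrank_directSum ℂ _)
  rw [hdim] at hq
  have hstable : ∀ (g : S), ∀ W ∈ X, W.map (ρ g) ∈ X := by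
    intro g W hW
    obtain ⟨hne, χ, rfl⟩ := (hX W).1 hW
    refine (hX _).2 ⟨?_, _, (ρ.map_weightSpace χ g).symm⟩
    rwa [Ne, ← Submodule.finrank_eq_zero, finrank_map_apply, Submodule.finrank_eq_zero]
  let := ρ.submoduleMulAction
  obtain ⟨W, hW, hWq⟩ := MulAction.exists_not_dvd_index_stabilizer_mul (S := S) X hstable
    (fun W : Submodule ℂ V => Module.finrank ℂ W) ρ.finrank_map_apply hq
  obtain ⟨-, χ, rfl⟩ := (hX W).1 hW
  refine ⟨χ, _, fun b hb => ?_, fun g hg v hv => ?_, hWq⟩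
  · rw [MulAction.mem_stabilizer_iff]
    change Submodule.map (ρ b) _ = _
    have key : ∀ b ∈ B, ∀ v ∈ ρ.weightSpace B χ, ρ b v ∈ ρ.weightSpace B χ := fun b hb v hv => by
      have h := mem_weightSpace.1 hv ⟨b, hb⟩
      exact h ▸ Submodule.smul_mem _ _ hv
    refine le_antisymm (Submodule.map_le_iff_le_comap.2 fun v hv => key b hb v hv)
      fun v hv => ⟨ρ b⁻¹ v, key _ (inv_mem hb) v hv, ?_⟩
    rw [← Module.End.mul_apply, ← map_mul]; simp
  · have h : Submodule.map (ρ g) _ = _ := MulAction.mem_stabilizer_iff.1 hg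
    exact h.le (Submodule.mem_map_of_mem hv)

end Representation

/-- Above a proper normal subgroup `A` of `p`-power index lies a larger normal subgroup which is
cyclic modulo `A`. -/
theorem Subgroup.exists_normal_gt_cyclic_mod {T : Type*} [Group T] [Finite T] {p : ℕ}
    (hp : p.Prime) (A : Subgroup T) [A.Normal] {k : ℕ} (hk : A.index = p ^ k) (hA : A ≠ ⊤) :
    ∃ B : Subgroup T, B.Normal ∧ A < B ∧ ∃ x : T, ∀ b ∈ B, ∃ i : ℤ, ∃ a ∈ A, b = x ^ i * a := by
  have : Fact p.Prime := ⟨hp⟩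
  have hpg : IsPGroup p (T ⧸ A) := IsPGroup.of_card (n := k) (by rw [← hk]; rfl)
  have : Nontrivial (T ⧸ A) := QuotientGroup.nontrivial_iff.2 hA
  have := hpg.center_nontrivial
  obtain ⟨⟨z, hz⟩, hz1⟩ := exists_ne (1 : Subgroup.center (T ⧸ A))
  obtain ⟨x, rfl⟩ := QuotientGroup.mk_surjective z
  have hx : x ∉ A := fun h => hz1 (Subtype.ext ((QuotientGroup.eq_one_iff x).2 h))
  have hn : (Subgroup.zpowers (x : T ⧸ A)).Normal := by
    refine ⟨fun n hn g => ?_⟩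
    have hnc : n ∈ Subgroup.center (T ⧸ A) := Subgroup.zpowers_le.2 hz hn
    rwa [Subgroup.mem_center_iff.1 hnc g, mul_inv_cancel_right]
  refine ⟨(Subgroup.zpowers (x : T ⧸ A)).comap (QuotientGroup.mk' A), hn.comap _, ?_, x, ?_⟩
  · refine SetLike.lt_iff_le_and_exists.2 ⟨fun a ha => ?_, x, ?_, hx⟩
    · rw [Subgroup.mem_comap, QuotientGroup.mk'_apply, (QuotientGroup.eq_one_iff a).2 ha]
      exact one_mem _
    · exact Subgroup.mem_zpowers _
  · rintro b ⟨i, hi⟩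
    refine ⟨i, (x ^ i)⁻¹ * b, QuotientGroup.eq.1 ?_, by group⟩
    simpa using hi

namespace Representation

/-- Suppose a normal subgroup `A` of `p`-power index acts by commuting operators. If `p ^ (a + 1)`
does not divide the dimension, then some subgroup of index dividing `p ^ a` which contains `A` has
an eigenvector. -/
theorem exists_eigenvector_of_not_dvd_finrank {p : ℕ} (hp : p.Prime) {S V : Type*} [Group S]
    [Finite S] [AddCommGroup V] [Module ℂ V] [FiniteDimensional ℂ V] (ρ : Representation ℂ S V)
    (A : Subgroup S) [A.Normal] {k a : ℕ} (hk : A.index = p ^ k)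
    (hcomm : ∀ x ∈ A, ∀ y ∈ A, Commute (ρ x) (ρ y)) (h : ¬ p ^ (a + 1) ∣ Module.finrank ℂ V) :
    ∃ H : Subgroup S, A ≤ H ∧ H.index ∣ p ^ a ∧
      ∃ v : V, v ≠ 0 ∧ ∀ g ∈ H, ∃ c : ℂ, ρ g v = c • v := by
  induction hn : A.index using Nat.strong_induction_on generalizing S V k a with | _ n ih => ?_
  obtain ⟨χ, T, hAT, hT, hTq⟩ := ρ.exists_weightSpace_not_dvd A hcomm h
  obtain ⟨b, -, hb⟩ := (Nat.dvd_prime_pow hp).1 (hk ▸ Subgroup.index_dvd_of_le hAT)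
  have hba : b ≤ a := by
    by_contra! hab
    exact hTq (hb ▸ (pow_dvd_pow p hab).mul_right _)
  have hW : ¬ p ^ (a - b + 1) ∣ Module.finrank ℂ (ρ.weightSpace A χ) := fun hd => hTq <| by
    rw [hb, show a + 1 = b + (a - b + 1) by omega, pow_add]
    exact mul_dvd_mul_left _ hd
  let σ : Representation ℂ T (ρ.weightSpace A χ) :=
    Subrepresentation.toRepresentation (ρ := ρ.comp T.subtype)
      ⟨ρ.weightSpace A χ, fun g v hv => hT g g.2 v hv⟩
  have hσ (g : T) (w : ρ.weightSpace A χ) : (σ g w : V) = ρ g w := rfl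
  suffices ∃ H : Subgroup T, A.subgroupOf T ≤ H ∧ H.index ∣ p ^ (a - b) ∧
      ∃ v : ρ.weightSpace A χ, v ≠ 0 ∧ ∀ g ∈ H, ∃ c : ℂ, σ g v = c • v by
    obtain ⟨H, hAH, hH, v, hv, hHv⟩ := this
    refine ⟨H.map T.subtype, fun x hx => ⟨⟨x, hAT hx⟩, hAH hx, rfl⟩, ?_, v, by simpa using hv, ?_⟩
    · rw [Subgroup.index_map_subtype, hb, ← Nat.sub_add_cancel hba, pow_add]
      simpa using mul_dvd_mul hH dvd_rfl
    · rintro - ⟨g, hg, rfl⟩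
      obtain ⟨c, hc⟩ := hHv g hg
      exact ⟨c, congrArg Subtype.val hc⟩
  by_cases hAtop : A.subgroupOf T = ⊤
  · have : Nontrivial (ρ.weightSpace A χ) := by
      by_contra hnt
      rw [not_nontrivial_iff_subsingleton] at hnt
      exact hW (by rw [Module.finrank_zero_of_subsingleton]; exact dvd_zero _)
    obtain ⟨v, hv⟩ := exists_ne (0 : ρ.weightSpace A χ)
    refine ⟨⊤, le_top, by simp, v, hv, fun g _ => ?_⟩
    have hg : g ∈ A.subgroupOf T := hAtop ▸ Subgroup.mem_top g
    exact ⟨χ ⟨g, hg⟩, Subtype.ext (mem_weightSpace.1 v.2 ⟨g, hg⟩)⟩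
  · obtain ⟨l, -, hl⟩ := (Nat.dvd_prime_pow hp).1
      (hk ▸ A.relIndex_dvd_index_of_normal T : (A.subgroupOf T).index ∣ p ^ k)
    obtain ⟨B, hBn, hAB, x, hx⟩ := (A.subgroupOf T).exists_normal_gt_cyclic_mod hp hl hAtop
    obtain ⟨m, -, hm⟩ := (Nat.dvd_prime_pow hp).1 (hl ▸ Subgroup.index_dvd_of_le hAB.le)
    have hBcomm : ∀ y ∈ B, ∀ z ∈ B, Commute (σ y) (σ z) := by
      have key : ∀ y ∈ B, ∃ (i : ℤ) (c : ℂ), σ y = c • σ (x ^ i) := by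
        intro y hy
        obtain ⟨i, d, hd, rfl⟩ := hx y hy
        refine ⟨i, χ ⟨d, hd⟩, LinearMap.ext fun w => ?_⟩
        have hdw : σ d w = χ ⟨d, hd⟩ • w := Subtype.ext (mem_weightSpace.1 w.2 ⟨d, hd⟩)
        rw [map_mul, Module.End.mul_apply, hdw, map_smul, LinearMap.smul_apply]
      intro y hy z hz
      obtain ⟨i, c, hc⟩ := key y hy
      obtain ⟨j, d, hd⟩ := key z hz
      rw [hc, hd]
      exact (((Commute.refl x).zpow_zpow i j).map σ).smul_left c |>.smul_right d
    obtain ⟨H, hBH, hH⟩ := ih B.index (by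
      rw [← hn]
      refine (Subgroup.index_strictAnti hAB).trans_le ?_
      exact Nat.le_of_dvd (Nat.pos_of_ne_zero Subgroup.index_ne_zero_of_finite)
        (A.relIndex_dvd_index_of_normal T)) σ B hm hBcomm hW rfl
    exact ⟨H, hAB.le.trans hBH, hH⟩

end Representation

namespace Representation

variable {G : Type*} [Group G]

/-- The vectors fixed by a normal subgroup, as a subrepresentation. -/
noncomputable def normalInvariants {V : Type*} [AddCommGroup V] [Module ℂ V]
    (ρ : Representation ℂ G V) (N : Subgroup G) [N.Normal] : Subrepresentation ρ :=
  ⟨invariants (ρ.comp N.subtype), fun g => ρ.le_comap_invariants N g⟩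

theorem mem_normalInvariants {V : Type*} [AddCommGroup V] [Module ℂ V] {ρ : Representation ℂ G V}
    {N : Subgroup G} [N.Normal] {v : V} :
    v ∈ ρ.normalInvariants N ↔ ∀ n ∈ N, ρ n v = v := by
  change (∀ n : N, ρ n v = v) ↔ _
  simp

theorem finrank_add_finrank_of_isCompl {V : Type*} [AddCommGroup V] [Module ℂ V]
    [FiniteDimensional ℂ V] {ρ : Representation ℂ G V} {σ τ : Subrepresentation ρ}
    (h : IsCompl σ τ) :
    Module.finrank ℂ σ.toSubmodule + Module.finrank ℂ τ.toSubmodule = Module.finrank ℂ V := by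
  refine Submodule.finrank_add_eq_of_isCompl ⟨disjoint_iff.2 ?_, codisjoint_iff.2 ?_⟩
  · exact congrArg Subrepresentation.toSubmodule (disjoint_iff.1 h.1)
  · exact congrArg Subrepresentation.toSubmodule (codisjoint_iff.1 h.2)

theorem normalInvariants_toRepresentation_eq_bot {V : Type*} [AddCommGroup V] [Module ℂ V]
    {ρ : Representation ℂ G V} {N : Subgroup G} [N.Normal] {σ : Subrepresentation ρ}
    (h : Disjoint (ρ.normalInvariants N) σ) : σ.toRepresentation.normalInvariants N = ⊥ := by
  refine eq_bot_iff.2 fun v hv => ?_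
  rw [mem_normalInvariants] at hv
  have : (v : V) ∈ ρ.normalInvariants N ⊓ σ :=
    ⟨mem_normalInvariants.2 fun n hn => congrArg Subtype.val (hv n hn), v.2⟩
  rw [disjoint_iff.1 h] at this
  exact Subtype.ext this

/-- If `d` divides the dimension of every irreducible representation without nonzero `N`-fixed
vectors, then it divides the dimension of every representation without such vectors. -/
theorem dvd_finrank_of_normalInvariants_eq_bot [Finite G] {N : Subgroup G} [N.Normal] {d : ℕ}
    (hd : ∀ (W : Type) [AddCommGroup W] [Module ℂ W] [FiniteDimensional ℂ W]
      (σ : Representation ℂ G W), σ.IsIrreducible → σ.normalInvariants N = ⊥ →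
      d ∣ Module.finrank ℂ W)
    {V : Type} [AddCommGroup V] [Module ℂ V] [FiniteDimensional ℂ V] (ρ : Representation ℂ G V)
    (h : ρ.normalInvariants N = ⊥) : d ∣ Module.finrank ℂ V := by
  induction hn : Module.finrank ℂ V using Nat.strong_induction_on generalizing V with | _ n ih => ?_
  rcases subsingleton_or_nontrivial V with hV | hV
  · rw [← hn, Module.finrank_zero_of_subsingleton]
    exact dvd_zero d
  by_cases hirr : ρ.IsIrreducible
  · exact hn ▸ hd V ρ hirr h
  have : Nontrivial (Subrepresentation ρ) :=
    ⟨⊥, ⊤, fun h => bot_ne_top (congrArg Subrepresentation.toSubmodule h)⟩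
  obtain ⟨σ, hσbot, hσtop⟩ : ∃ σ : Subrepresentation ρ, σ ≠ ⊥ ∧ σ ≠ ⊤ := by
    by_contra! hno
    exact hirr ⟨fun σ => or_iff_not_imp_left.2 (hno σ)⟩
  obtain ⟨τ, hστ⟩ := exists_isCompl σ
  have hadd := finrank_add_finrank_of_isCompl hστ
  have hpos : ∀ σ : Subrepresentation ρ, σ ≠ ⊥ → 0 < Module.finrank ℂ σ.toSubmodule :=
    fun σ hσ => Nat.pos_of_ne_zero fun h0 => hσ <|
      Subrepresentation.toSubmodule_injective (Submodule.finrank_eq_zero.1 h0)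
  have h1 := hpos σ hσbot
  have h2 := hpos τ fun hτ => hσtop (by rw [← hστ.sup_eq_top, hτ, sup_bot_eq])
  have hdisj : ∀ σ, Disjoint (ρ.normalInvariants N) σ := fun σ => h ▸ disjoint_bot_left
  rw [← hn, ← hadd]
  exact dvd_add
    (ih _ (by omega) σ.toRepresentation (normalInvariants_toRepresentation_eq_bot (hdisj σ)) rfl)
    (ih _ (by omega) τ.toRepresentation (normalInvariants_toRepresentation_eq_bot (hdisj τ)) rfl)

theorem finrank_normalInvariants_ofMulAction [Finite G] (N : Subgroup G) [hN : N.Normal]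
    (H : Subgroup G) :
    Module.finrank ℂ ((ofMulAction ℂ G (G ⧸ H)).normalInvariants N).toSubmodule =
      (H ⊔ N).index := by
  classical
  have := Fintype.ofFinite (G ⧸ (H ⊔ N))
  let π : G ⧸ H → G ⧸ (H ⊔ N) := Subgroup.quotientMapOfLE le_sup_left
  let L : (G ⧸ (H ⊔ N) → ℂ) →ₗ[ℂ] MonoidAlgebra ℂ (G ⧸ H) :=
    (MonoidAlgebra.coeffLinearEquiv ℂ).symm.toLinearMap ∘ₗ
      (Finsupp.linearEquivFunOnFinite ℂ ℂ (G ⧸ H)).symm.toLinearMap ∘ₗ LinearMap.funLeft ℂ ℂ π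
  have hL (f) (x : G ⧸ H) : (L f).coeff x = f (π x) := rfl
  have hinj : Function.Injective L := by
    intro f f' hff
    funext y
    obtain ⟨g, rfl⟩ := QuotientGroup.mk_surjective y
    exact congrArg (fun u => MonoidAlgebra.coeff u (g : G ⧸ H)) hff
  have hrange : LinearMap.range L =
      ((ofMulAction ℂ G (G ⧸ H)).normalInvariants N).toSubmodule := by
    refine le_antisymm ?_ fun u hu => ?_
    · rintro - ⟨f, rfl⟩
      refine mem_normalInvariants.2 fun n hn => MonoidAlgebra.ext (Finsupp.ext fun x => ?_)
      rw [coeff_ofMulAction, hL, hL]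
      obtain ⟨g, rfl⟩ := QuotientGroup.mk_surjective x
      refine congrArg f (QuotientGroup.eq.2 ?_)
      refine le_sup_right (a := H) (b := N) ?_
      change (n⁻¹ * g)⁻¹ * g ∈ N
      simpa [mul_assoc] using hN.conj_mem n hn g⁻¹
    · have hu' := mem_normalInvariants.1 hu
      have key (g g' : G) (h : g⁻¹ * g' ∈ H ⊔ N) :
          u.coeff (g : G ⧸ H) = u.coeff (g' : G ⧸ H) := by
        obtain ⟨n, hn, x, hx, hnx⟩ := Subgroup.mem_sup_of_normal_left.1 (sup_comm H N ▸ h)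
        have h1 := congrArg (fun u => MonoidAlgebra.coeff u (g : G ⧸ H))
          (hu' _ (hN.conj_mem n⁻¹ (inv_mem hn) g))
        rw [coeff_ofMulAction] at h1
        refine h1.symm.trans (congrArg u.coeff (QuotientGroup.eq.2 ?_))
        have h2 : g' = g * (n * x) := by rw [hnx]; group
        simpa [h2, mul_assoc] using hx
      refine ⟨fun y => u.coeff (y.out : G ⧸ H), MonoidAlgebra.ext (Finsupp.ext fun x => ?_)⟩
      rw [hL]
      obtain ⟨g, rfl⟩ := QuotientGroup.mk_surjective x
      exact key _ _ (QuotientGroup.eq.1 (QuotientGroup.out_eq' (π g)))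
  rw [← hrange, LinearMap.finrank_range_of_inj hinj, Module.finrank_fintype_fun_eq_card,
    ← Nat.card_eq_fintype_card]
  rfl

theorem finrank_ofMulAction_quotient [Finite G] (H : Subgroup G) :
    Module.finrank ℂ (MonoidAlgebra ℂ (G ⧸ H)) = H.index := by
  have := Fintype.ofFinite (G ⧸ H)
  rw [(MonoidAlgebra.coeffLinearEquiv ℂ).finrank_eq, Module.finrank_finsupp_self,
    ← Nat.card_eq_fintype_card]
  rfl

end Representation

theorem FDRep.simple_of_isIrreducible {G : Type} [Group G] [Finite G] {W : Type} [AddCommGroup W]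
    [Module ℂ W] [FiniteDimensional ℂ W] {σ : Representation ℂ G W} (h : σ.IsIrreducible) :
    Simple (FDRep.of σ) := by
  have : NeZero (Nat.card G : ℂ) := ⟨Nat.cast_ne_zero.2 Nat.card_pos.ne'⟩
  rw [FDRep.simple_iff_end_is_rank_one, ← (FDRep.forget₂HomLinearEquiv _ _).finrank_eq,
    ← (Representation.linHom.invariantsEquivRepHom _ _).finrank_eq,
    ← h.finrank_intertwiningMap_self]
  exact (Representation.invariantsEquivIntertwiningMap σ σ).finrank_eq

/-- A nonzero subrepresentation of a simple representation is everything. -/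
theorem FDRep.toSubmodule_eq_top {G : Type} [Group G] (V : FDRep ℂ G) [Simple V]
    (σ : Subrepresentation V.ρ) (h : σ ≠ ⊥) : σ.toSubmodule = ⊤ := by
  let f : FDRep.of σ.toRepresentation ⟶ V :=
    ⟨InducedCategory.homMk (ModuleCat.ofHom σ.toSubmodule.subtype), fun g => rfl⟩
  have hf (x : σ.toSubmodule) : f.hom.hom.hom x = (x : V) := rfl
  have hmono : Mono f := by
    have : Mono ((forget₂ (FDRep ℂ G) (FGModuleCat ℂ)).map f) := by
      refine ConcreteCategory.mono_of_injective _ ?_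
      exact Subtype.val_injective
    exact (forget₂ (FDRep ℂ G) (FGModuleCat ℂ)).mono_of_mono_map this
  have hne : f ≠ 0 := fun h0 => h <| by
    refine eq_bot_iff.2 fun v hv => ?_
    have h1 := hf ⟨v, hv⟩
    rw [h0] at h1
    exact h1.symm
  have := isIso_of_mono_of_nonzero hne
  refine eq_top_iff.2 fun v _ => ?_
  obtain ⟨w, rfl⟩ := (FDRep.isoToLinearEquiv (asIso f)).surjective v
  exact w.2

namespace Subgroup

/-- A normal `p`-complement is characteristic. -/
theorem Characteristic.of_coprime_of_index_eq_pow {T : Type*} [Group T] [Finite T] {p k : ℕ}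
    (A : Subgroup T) [A.Normal] (hA : (Nat.card A).Coprime p) (hk : A.index = p ^ k) :
    A.Characteristic := by
  have hmem : ∀ x : T, x ∈ A ↔ x ^ Nat.card A = 1 := by
    intro x
    refine ⟨fun hx => congrArg Subtype.val (pow_card_eq_one' (x := (⟨x, hx⟩ : A))), fun hx => ?_⟩
    rw [← QuotientGroup.eq_one_iff, ← orderOf_eq_one_iff]
    refine Nat.eq_one_of_dvd_coprimes (hA.pow_right k) (orderOf_dvd_of_pow_eq_one ?_) ?_
    · rw [← QuotientGroup.mk_pow, hx]; rfl
    · rw [← hk]; exact _root_.orderOf_dvd_natCard _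
  refine characteristic_iff_le_comap.2 fun φ x hx => ?_
  rw [mem_comap, hmem]
  change φ x ^ _ = 1
  rw [← map_pow, (hmem x).1 hx, map_one]

/-- If the normal subgroup `A ≤ N` has `p`-power index in `N`, then it has `p`-power index in
some subgroup `S ≥ N` of index coprime to `p`. -/
theorem exists_index_coprime_of_relIndex_eq_pow {G : Type*} [Group G] [Finite G] {p k : ℕ}
    (hp : p.Prime) {A N : Subgroup G} [A.Normal] (hk : A.relIndex N = p ^ k) :
    ∃ S : Subgroup G, N ≤ S ∧ (∃ l, A.relIndex S = p ^ l) ∧ ¬ p ∣ S.index := by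
  have : Fact p.Prime := ⟨hp⟩
  let π := QuotientGroup.mk' A
  have hker : π.ker = A := QuotientGroup.ker_mk' A
  have hcard : ∀ M : Subgroup G, Nat.card (M.map π) = A.relIndex M := fun M => by
    rw [← relIndex_ker, hker]
  obtain ⟨Q, hQ⟩ := (IsPGroup.of_card (p := p) (n := k) ((hcard N).trans hk)).exists_le_sylow
  refine ⟨Q.comap π, map_le_iff_le_comap.1 hQ, ?_, ?_⟩
  · obtain ⟨l, hl⟩ := IsPGroup.iff_card.1 Q.2
    refine ⟨l, ?_⟩
    rw [← hcard, map_comap_eq_self_of_surjective (QuotientGroup.mk'_surjective A)]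
    exact hl
  · rw [index_comap_of_surjective _ (QuotientGroup.mk'_surjective A)]
    exact Q.not_dvd_index

end Subgroup

/-- A subgroup of index dividing `p ^ a` in `S` contains `N` as soon as `p ^ a` divides
`|G : H| - |G : HN|`, provided that `p` does not divide `|G : S|`. -/
theorem Subgroup.le_of_index_sup_add {G : Type*} [Group G] [Finite G] {p a m : ℕ} (hp : p.Prime)
    {H N S : Subgroup G} (hHS : H ≤ S) (hNS : N ≤ S) (hS : ¬ p ∣ S.index)
    (hH : H.relIndex S ∣ p ^ a) (hm : (H ⊔ N).index + p ^ a * m = H.index) : N ≤ H := by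
  have hK : H ⊔ N ≤ S := sup_le hHS hNS
  have h1 := relIndex_mul_index hHS
  have h2 := relIndex_mul_index hK
  have hSpos : 0 < S.index := Nat.pos_of_ne_zero index_ne_zero_of_finite
  have hKpos : 0 < (H ⊔ N).relIndex S := Nat.pos_of_ne_zero index_ne_zero_of_finite
  have hle : H.relIndex S ≤ p ^ a := Nat.le_of_dvd (pow_pos hp.pos a) hH
  have hmul : (H.relIndex S - (H ⊔ N).relIndex S) * S.index = p ^ a * m := by
    rw [Nat.sub_mul, h1, h2]; omega
  have hdvd : p ^ a ∣ H.relIndex S - (H ⊔ N).relIndex S :=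
    (((Nat.Prime.coprime_iff_not_dvd hp).2 hS).pow_left a).dvd_of_dvd_mul_right ⟨m, hmul⟩
  have hzero := Nat.eq_zero_of_dvd_of_lt hdvd (by
    have := pow_pos hp.pos a
    omega)
  rw [hzero, zero_mul] at hmul
  have hidx : (H ⊔ N).index = H.index := by omega
  have hrel := relIndex_mul_index (le_sup_left : H ≤ H ⊔ N)
  rw [hidx] at hrel
  have hone : H.relIndex (H ⊔ N) = 1 :=
    Nat.eq_of_mul_eq_mul_right (Nat.pos_of_ne_zero index_ne_zero_of_finite)
      (hrel.trans (one_mul _).symm)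
  exact le_sup_right.trans (relIndex_eq_one.1 hone)

namespace FDRep

variable {G : Type} [Group G]

/-- The character of a representation which is trivial on `N` is constant on `N`. -/
theorem character_eq_of_normalInvariants_eq_top {V : FDRep ℂ G} {N : Subgroup G} [N.Normal]
    (h : (Representation.normalInvariants V.ρ N).toSubmodule = ⊤) {n : G} (hn : n ∈ N) :
    V.character n = V.character 1 := by
  have : V.ρ n = V.ρ 1 := LinearMap.ext fun v => by
    rw [map_one, Module.End.one_apply]
    exact Representation.mem_normalInvariants.1 (h.ge Submodule.mem_top) n hn
  rw [character, character, this]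

/-- A nonzero representation whose character is constant on `N` has nonzero `N`-fixed vectors. -/
theorem finrank_eq_zero_of_normalInvariants_eq_bot [Finite G] {V : FDRep ℂ G} {N : Subgroup G}
    [N.Normal] (h : Representation.normalInvariants V.ρ N = ⊥)
    (hchar : ∀ n ∈ N, V.character n = V.character 1) : Module.finrank ℂ V = 0 := by
  have := Fintype.ofFinite N
  have hcard : (Nat.card N : ℂ) ≠ 0 := Nat.cast_ne_zero.2 Nat.card_pos.ne'
  have := invertibleOfNonzero hcard
  have havg := Representation.card_inv_mul_sum_char_eq_finrank
    (MonoidHom.comp V.ρ N.subtype : Representation ℂ N V)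
  have hinv : Representation.invariants (MonoidHom.comp V.ρ N.subtype) = ⊥ :=
    congrArg Subrepresentation.toSubmodule h
  have hsum : ∀ n ∈ (Finset.univ : Finset N),
      Representation.character (MonoidHom.comp V.ρ N.subtype) n = V.character 1 :=
    fun n _ => hchar n n.2
  rw [hinv, finrank_bot, Finset.sum_congr rfl hsum, Finset.sum_const,
    Finset.card_univ, ← Nat.card_eq_fintype_card, nsmul_eq_mul, inv_mul_cancel_left₀ hcard,
    char_one] at havg
  exact_mod_cast havg

/-- Suppose `N` has the abelian normal `p`-complement `A`. If `p ^ a` divides the degrees of all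
irreducible characters whose kernel does not contain `N`, then every irreducible character of degree
not divisible by `p ^ (a + 1)` contains `N'` in its kernel. -/
theorem character_eq_of_mem_commutator [Finite G] {N : Subgroup G} [N.Normal] {p : ℕ}
    (hp : p.Prime) (A : Subgroup N) [A.Normal] (hAab : ∀ a b : A, a * b = b * a)
    (hAcop : (Nat.card A).Coprime p) {k : ℕ} (hk : A.index = p ^ k) (V : FDRep ℂ G) [Simple V]
    {a : ℕ} (hV : ¬ p ^ (a + 1) ∣ Module.finrank ℂ V)
    (hmin : ∀ W : FDRep ℂ G, Simple W → (¬ ∀ n ∈ N, W.character n = W.character 1) →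
      p ^ a ∣ Module.finrank ℂ W) :
    ∀ n ∈ ⁅N, N⁆, V.character n = V.character 1 := by
  have := Subgroup.Characteristic.of_coprime_of_index_eq_pow A hAcop hk
  let B : Subgroup G := A.map N.subtype
  have hBrel : B.relIndex N = p ^ k := by
    rw [← hk, Subgroup.relIndex, Subgroup.subgroupOf,
      Subgroup.comap_map_eq_self_of_injective N.subtype_injective]
  obtain ⟨S, hNS, ⟨l, hl⟩, hS⟩ := Subgroup.exists_index_coprime_of_relIndex_eq_pow hp hBrel
  have hcomm : ∀ x ∈ B.subgroupOf S, ∀ y ∈ B.subgroupOf S,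
      Commute (V.ρ (x : G)) (V.ρ (y : G)) := by
    rintro x ⟨x', hx', hxx⟩ y ⟨y', hy', hyy⟩
    have h := congrArg (fun z : A => (z : G)) (hAab ⟨x', hx'⟩ ⟨y', hy'⟩)
    have h' : (x : G) * y = y * x := by
      rw [← show (x' : G) = x from hxx, ← show (y' : G) = y from hyy]
      exact h
    exact (show Commute (x : G) y from h').map V.ρ
  obtain ⟨H', -, hH', v, hv, hHv⟩ := Representation.exists_eigenvector_of_not_dvd_finrank hp
    (MonoidHom.comp V.ρ S.subtype : Representation ℂ S V) (B.subgroupOf S) hl hcomm hV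
  let H := H'.map S.subtype
  have hNH : N ≤ H := by
    obtain ⟨τ, hτ⟩ := exists_isCompl
      ((Representation.ofMulAction ℂ G (G ⧸ H)).normalInvariants N)
    obtain ⟨m, hm⟩ := Representation.dvd_finrank_of_normalInvariants_eq_bot (d := p ^ a)
      (fun W _ _ _ σ hσ hσN => hmin (FDRep.of σ) (FDRep.simple_of_isIrreducible hσ) fun hc => by
        have h0 := finrank_eq_zero_of_normalInvariants_eq_bot (V := FDRep.of σ) hσN hc
        have : Subsingleton W := Module.finrank_zero_iff.1 h0
        exact hσ.bot_ne_top (Subrepresentation.toSubmodule_injective (Subsingleton.elim _ _)))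
      τ.toRepresentation
      (Representation.normalInvariants_toRepresentation_eq_bot hτ.disjoint)
    have hadd := Representation.finrank_add_finrank_of_isCompl hτ
    rw [Representation.finrank_normalInvariants_ofMulAction,
      Representation.finrank_ofMulAction_quotient, hm] at hadd
    refine Subgroup.le_of_index_sup_add hp (Subgroup.map_subtype_le H') hNS hS ?_ hadd
    rwa [Subgroup.relIndex, Subgroup.subgroupOf,
      Subgroup.comap_map_eq_self_of_injective S.subtype_injective]
  have heig : ∀ n ∈ N, ∃ c : ℂ, V.ρ n v = c • v := by
    intro n hn
    obtain ⟨g, hg, rfl⟩ := hNH hn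
    exact hHv g hg
  have hfix : v ∈ Representation.normalInvariants V.ρ ⁅N, N⁆ := by
    rw [Representation.mem_normalInvariants]
    let T : Subgroup G :=
      { carrier := {g | V.ρ g v = v}
        mul_mem' := fun {x y} hx hy => by
          change V.ρ (x * y) v = v
          rw [map_mul, Module.End.mul_apply, hy, hx]
        one_mem' := by simp
        inv_mem' := fun {x} hx => by
          change V.ρ x⁻¹ v = v
          nth_rw 1 [← (hx : V.ρ x v = v), ← Module.End.mul_apply, ← map_mul]
          simp }
    have hT : ⁅N, N⁆ ≤ T := by
      refine Subgroup.commutator_le.2 fun x hx y hy => ?_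
      obtain ⟨c, hc⟩ := heig x⁻¹ (inv_mem hx)
      obtain ⟨d, hd⟩ := heig y⁻¹ (inv_mem hy)
      have hxy : V.ρ (x⁻¹ * y⁻¹) v = V.ρ (y⁻¹ * x⁻¹) v := by
        rw [map_mul, map_mul, Module.End.mul_apply, Module.End.mul_apply, hd, hc, map_smul,
          map_smul, hd, hc, smul_comm]
      change V.ρ (x * y * x⁻¹ * y⁻¹) v = v
      rw [mul_assoc, map_mul, Module.End.mul_apply, hxy, ← Module.End.mul_apply, ← map_mul]
      simp
    exact hT
  refine fun n hn => character_eq_of_normalInvariants_eq_top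
    (V.toSubmodule_eq_top _ fun h => hv ?_) hn
  rw [h] at hfix
  exact hfix

end FDRep

/-- **Theorem 3.1.** Let `N ⊴ G` have an abelian normal `p`-complement `A`
(an abelian normal subgroup of `N` of order coprime to `p` and of `p`-power index in `N`).
If `χ ∈ Irr(G|N)` (formalized by a simple `V : FDRep ℂ G` whose character kernel does not
contain `N`) is chosen with the `p`-part of `χ(1)` as small as possible, then
`N' ⊆ ker χ`.  In particular, if `N > 1` then `cd(G|N')` is a proper subset of `cd(G|N)`. -/
theorem stmt1 (G : Type) [Group G] [Fintype G] (N : Subgroup G) [N.Normal]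
    (p : ℕ) (hp : p.Prime)
    (A : Subgroup ↥N) (hA : A.Normal) (hAab : ∀ a b : ↥A, a * b = b * a)
    (hAcop : (Nat.card A).Coprime p) (hAindex : ∃ k : ℕ, A.index = p ^ k)
    (V : FDRep ℂ G) (hV : Simple V)
    (hVN : ¬ ∀ n ∈ N, V.character n = V.character 1)
    (hmin : ∀ W : FDRep ℂ G, Simple W →
      (¬ ∀ n ∈ N, W.character n = W.character 1) →
      p ^ ((Module.finrank ℂ V).factorization p) ≤ p ^ ((Module.finrank ℂ W).factorization p)) :
    (∀ n ∈ ⁅N, N⁆, V.character n = V.character 1) ∧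
      (N ≠ ⊥ → cdOver G ⁅N, N⁆ ⊂ cdOver G N) := by
  obtain ⟨k, hk⟩ := hAindex
  have key (W : FDRep ℂ G) (hW : Simple W)
      (hWV : (Module.finrank ℂ W).factorization p ≤ (Module.finrank ℂ V).factorization p)
      (hWN : ¬ ∀ n ∈ N, W.character n = W.character 1) :
      ∀ n ∈ ⁅N, N⁆, W.character n = W.character 1 := by
    have hpos (U : FDRep ℂ G) (hU : ¬ ∀ n ∈ N, U.character n = U.character 1) :
        Module.finrank ℂ U ≠ 0 := fun h0 => hU fun n _ => by
      have : Subsingleton U := Module.finrank_zero_iff.1 h0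
      rw [FDRep.character, FDRep.character, Subsingleton.elim (U.ρ n) (U.ρ 1)]
    refine FDRep.character_eq_of_mem_commutator hp A hAab hAcop hk W
      (Nat.pow_succ_factorization_not_dvd (hpos W hWN) hp) fun U hU hUN => ?_
    refine (pow_dvd_pow p (hWV.trans ?_)).trans (Nat.ordProj_dvd _ p)
    exact (Nat.pow_le_pow_iff_right hp.one_lt).1 (hmin U hU hUN)
  refine ⟨key V hV le_rfl hVN, fun _ => ⟨?_, fun hsub => ?_⟩⟩
  · rintro d ⟨W, hW, hWN, rfl⟩
    exact ⟨W, hW, fun h => hWN fun n hn => h n (Subgroup.commutator_le_self N hn), rfl⟩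
  · obtain ⟨W, hW, hWN, hdim⟩ := hsub ⟨V, hV, hVN, rfl⟩
    exact hWN (key W hW (by rw [hdim])
      fun h => hWN fun n hn => h n (Subgroup.commutator_le_self N hn))
end

section
/- Let G be a finite group and N a nilpotent normal subgroup of G. Then the derived length of N is at most |cd(G|N)|. -/
open CategoryTheory

section DegreeBound

open Module Representation

section Bridge

variable {G : Type} [Group G]

theorem cdOver_mono {M N : Subgroup G} (h : M ≤ N) : cdOver G M ⊆ cdOver G N :=
  fun _ ⟨V, hV, hM, hd⟩ => ⟨V, hV, fun hN => hM fun n hn => hN n (h hn), hd⟩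

/-- The span of the orbit of a vector. -/
def orbitSpan {V : Type} [AddCommGroup V] [Module ℂ V]
    (ρ : Representation ℂ G V) (v : V) : Subrepresentation ρ where
  toSubmodule := Submodule.span ℂ (Set.range fun g => ρ g v)
  apply_mem_toSubmodule g w hw := by
    induction hw using Submodule.span_induction with
    | mem x hx =>
      obtain ⟨k, rfl⟩ := hx
      exact Submodule.subset_span ⟨g * k, by simp⟩
    | zero => simp
    | add x y _ _ hx hy => rw [map_add]; exact Submodule.add_mem _ hx hy
    | smul a x _ hx => rw [map_smul]; exact Submodule.smul_mem _ a hx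

variable [Finite G]

theorem simple_of_isIrreducible {V : Type} [AddCommGroup V] [Module ℂ V] [FiniteDimensional ℂ V]
    (ρ : Representation ℂ G V) [ρ.IsIrreducible] : Simple (FDRep.of ρ) := by
  rw [FDRep.simple_iff_end_is_rank_one]
  rw [← (linHom.invariantsEquivFDRepHom (FDRep.of ρ) (FDRep.of ρ)).finrank_eq]
  have h := IsIrreducible.finrank_intertwiningMap_self ρ
  rw [← (invariantsEquivIntertwiningMap ρ ρ).finrank_eq] at h
  exact h

theorem apply_eq_one_of_character_eq {V : Type} [AddCommGroup V] [Module ℂ V]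
    [FiniteDimensional ℂ V] (ρ : Representation ℂ G V) (N : Subgroup G)
    (h : ∀ n ∈ N, (FDRep.of ρ).character n = (FDRep.of ρ).character 1) {n : G} (hn : n ∈ N) :
    ρ n = 1 := by
  have := Fintype.ofFinite N
  have : Invertible (Nat.card N : ℂ) := invertibleOfNonzero (by simp)
  have h1 := FDRep.average_char_eq_finrank_invariants (FDRep.of (ρ.comp N.subtype))
  have h2 : ∀ g : N, (FDRep.of (ρ.comp N.subtype)).character g = finrank ℂ V := fun g => by
    have := h g g.2
    rw [FDRep.char_one] at this
    exact this
  rw [Finset.sum_congr rfl (fun g _ => h2 g)] at h1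
  rw [Finset.sum_const, Finset.card_univ, ← Nat.card_eq_fintype_card, nsmul_eq_mul,
    inv_mul_cancel_left₀ (by simp)] at h1
  have h3 : finrank ℂ (invariants (ρ.comp N.subtype)) = finrank ℂ V := by
    exact_mod_cast h1.symm
  have h4 := Submodule.eq_top_of_finrank_eq h3
  ext v
  have hv : v ∈ invariants (ρ.comp N.subtype) := h4 ▸ Submodule.mem_top
  exact hv ⟨n, hn⟩

theorem finrank_mem_cdOver {V : Type} [AddCommGroup V] [Module ℂ V] [FiniteDimensional ℂ V]
    (ρ : Representation ℂ G V) [ρ.IsIrreducible] {N : Subgroup G} {n : G} (hn : n ∈ N)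
    (h : ρ n ≠ 1) : finrank ℂ V ∈ cdOver G N :=
  ⟨FDRep.of ρ, simple_of_isIrreducible ρ,
    fun hc => h (apply_eq_one_of_character_eq ρ N hc hn), rfl⟩

theorem finrank_le_card_of_simple (V : FDRep ℂ G) [Simple V] : finrank ℂ V ≤ Nat.card G := by
  have := Fintype.ofFinite G
  rcases subsingleton_or_nontrivial V with hV | hV
  · rw [finrank_zero_of_subsingleton]; exact Nat.zero_le _
  obtain ⟨v, hv⟩ := exists_ne (0 : V)
  let S := orbitSpan V.ρ v
  let f : FDRep.of S.toRepresentation ⟶ V :=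
    FDRep.forget₂HomLinearEquiv (FDRep.of S.toRepresentation) V
      (Rep.ofHom ⟨S.toSubmodule.subtype, fun g => by ext; rfl⟩)
  have hfun : ∀ x : S.toSubmodule, f.hom.hom x = (x : V) := fun x => rfl
  have : Mono f := by
    apply ConcreteCategory.mono_of_injective
    intro x y hxy
    exact Subtype.ext hxy
  have hf : f ≠ 0 := by
    intro h0
    have h1 : v ∈ S.toSubmodule := Submodule.subset_span ⟨1, by simp⟩
    have h2 := hfun ⟨v, h1⟩
    rw [h0] at h2
    exact hv h2.symm
  have := isIso_of_mono_of_nonzero hf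
  rw [← (FDRep.isoToLinearEquiv (asIso f)).finrank_eq]
  change finrank ℂ S.toSubmodule ≤ _
  rw [Nat.card_eq_fintype_card]
  exact finrank_range_le_card _

theorem cdOver_finite (N : Subgroup G) : (cdOver G N).Finite :=
  (Set.finite_Iic (Nat.card G)).subset fun d ⟨V, hV, _, hd⟩ => by
    subst hd; exact finrank_le_card_of_simple V

end Bridge

section Subreps

variable {G : Type} [Group G] {V : Type} [AddCommGroup V] [Module ℂ V]
  {ρ : Representation ℂ G V}

theorem Subrepresentation.isIrreducible_of_isAtom {τ : Subrepresentation ρ} (h : IsAtom τ) :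
    τ.toRepresentation.IsIrreducible where
  exists_pair_ne := by
    refine ⟨⊥, ⊤, fun hbt => h.1 (Subrepresentation.toSubmodule_injective ?_)⟩
    have h1 : (⊥ : Submodule ℂ τ.toSubmodule) = ⊤ :=
      congrArg Subrepresentation.toSubmodule hbt
    refine (Submodule.eq_bot_iff _).2 fun x hx => ?_
    have h2 : (⟨x, hx⟩ : τ.toSubmodule) ∈ (⊥ : Submodule ℂ τ.toSubmodule) :=
      h1 ▸ Submodule.mem_top
    exact congrArg Subtype.val ((Submodule.mem_bot ℂ).1 h2)
  eq_bot_or_eq_top σ := by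
    let σ' : Subrepresentation ρ :=
      ⟨σ.toSubmodule.map τ.toSubmodule.subtype, by
        rintro g _ ⟨x, hx, rfl⟩
        exact ⟨_, σ.apply_mem_toSubmodule g hx, rfl⟩⟩
    have hle : σ' ≤ τ := by
      rintro _ ⟨x, hx, rfl⟩
      exact x.2
    rcases h.le_iff.1 hle with h0 | h0
    · left
      apply Subrepresentation.toSubmodule_injective
      have h1 : σ.toSubmodule.map τ.toSubmodule.subtype = ⊥ :=
        congrArg Subrepresentation.toSubmodule h0
      exact Submodule.map_injective_of_injective (f := τ.toSubmodule.subtype)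
        Subtype.val_injective (h1.trans (Submodule.map_bot _).symm)
    · right
      apply Subrepresentation.toSubmodule_injective
      refine (Submodule.eq_top_iff').2 fun x => ?_
      have h1 : (x : V) ∈ σ.toSubmodule.map τ.toSubmodule.subtype := by
        have : σ.toSubmodule.map τ.toSubmodule.subtype = τ.toSubmodule :=
          congrArg Subrepresentation.toSubmodule h0
        rw [this]; exact x.2
      obtain ⟨y, hy, hyx⟩ := h1
      rwa [← Subtype.ext hyx]

theorem Subrepresentation.exists_atom_padicValNat_le [Finite G] [FiniteDimensional ℂ V]
    (p : ℕ) [Fact p.Prime] (σ : Subrepresentation ρ) (hσ : σ ≠ ⊥) :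
    ∃ τ ≤ σ, IsAtom τ ∧
      padicValNat p (finrank ℂ τ.toSubmodule) ≤ padicValNat p (finrank ℂ σ.toSubmodule) := by
  induction hn : finrank ℂ σ.toSubmodule using Nat.strong_induction_on generalizing σ with
  | _ n ih =>
    by_cases hat : IsAtom σ
    · exact ⟨σ, le_rfl, hat, hn ▸ le_rfl⟩
    have : ∃ α < σ, α ≠ ⊥ := by
      simpa [IsAtom, hσ] using hat
    obtain ⟨α, hα, hα0⟩ := this
    obtain ⟨γ, hγ⟩ := exists_isCompl α
    have hsum : α ⊔ γ ⊓ σ = σ := by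
      apply Subrepresentation.toSubmodule_injective
      rw [toSubmodule_sup, toSubmodule_inf]
      have h1 : α.toSubmodule ≤ σ.toSubmodule := hα.le
      rw [← sup_inf_assoc_of_le _ h1, ← toSubmodule_sup, hγ.sup_eq_top]
      exact top_inf_eq _
    have hinf : α ⊓ (γ ⊓ σ) = ⊥ := by
      rw [← inf_assoc, hγ.inf_eq_bot, bot_inf_eq]
    have hβ : γ ⊓ σ ≠ ⊥ := by
      intro h; rw [h, sup_bot_eq] at hsum; exact hα.ne hsum
    have hdim : finrank ℂ α.toSubmodule + finrank ℂ (γ ⊓ σ).toSubmodule = n := by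
      have h := Submodule.finrank_sup_add_finrank_inf_eq α.toSubmodule (γ ⊓ σ).toSubmodule
      rw [← toSubmodule_sup, hsum, ← toSubmodule_inf, hinf, hn] at h
      have h0 : finrank ℂ (⊥ : Subrepresentation ρ).toSubmodule = 0 := finrank_bot ℂ V
      omega
    have hpos : ∀ β : Subrepresentation ρ, β ≠ ⊥ → 0 < finrank ℂ β.toSubmodule := by
      intro β hβ
      have : β.toSubmodule ≠ ⊥ := fun h => hβ (Subrepresentation.toSubmodule_injective h)
      have := Submodule.nontrivial_iff_ne_bot.2 this
      exact finrank_pos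
    have hα1 := hpos α hα0
    have hβ1 := hpos _ hβ
    have key : padicValNat p (finrank ℂ α.toSubmodule) ≤ padicValNat p n ∨
        padicValNat p (finrank ℂ (γ ⊓ σ).toSubmodule) ≤ padicValNat p n := by
      by_contra! hc
      have h1 := (padicValNat_dvd_iff_le hα1.ne').2 (Nat.succ_le_of_lt hc.1)
      have h2 := (padicValNat_dvd_iff_le hβ1.ne').2 (Nat.succ_le_of_lt hc.2)
      have h3 := dvd_add h1 h2
      rw [hdim, padicValNat_dvd_iff_le (by omega)] at h3
      omega
    rcases key with hk | hk
    · obtain ⟨τ, hτ, hτa, hτv⟩ := ih _ (by omega) α hα0 rfl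
      exact ⟨τ, hτ.trans hα.le, hτa, hτv.trans hk⟩
    · obtain ⟨τ, hτ, hτa, hτv⟩ := ih _ (by omega) (γ ⊓ σ) hβ rfl
      exact ⟨τ, hτ.trans inf_le_right, hτa, hτv.trans hk⟩

theorem Subrepresentation.exists_atom_le [Finite G] [FiniteDimensional ℂ V]
    (σ : Subrepresentation ρ) (hσ : σ ≠ ⊥) : ∃ τ ≤ σ, IsAtom τ := by
  have : Fact (Nat.Prime 2) := ⟨Nat.prime_two⟩
  obtain ⟨τ, h, hτ, -⟩ := σ.exists_atom_padicValNat_le 2 hσ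
  exact ⟨τ, h, hτ⟩

theorem Subrepresentation.top_ne_bot [Nontrivial V] : (⊤ : Subrepresentation ρ) ≠ ⊥ := fun h =>
  _root_.top_ne_bot (α := Submodule ℂ V) (congrArg Subrepresentation.toSubmodule h)

theorem Representation.IsIrreducible.nontrivial [ρ.IsIrreducible] : Nontrivial V := by
  by_contra h
  have := not_nontrivial_iff_subsingleton.1 h
  exact bot_ne_top (α := Subrepresentation ρ)
    (Subrepresentation.toSubmodule_injective (Subsingleton.elim _ _))

/-- The vectors fixed by a normal subgroup. -/
noncomputable def Representation.fixedBy (ρ : Representation ℂ G V) (K : Subgroup G) [K.Normal] :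
    Subrepresentation ρ where
  toSubmodule := invariants (ρ.comp K.subtype)
  apply_mem_toSubmodule g _ hv := le_comap_invariants ρ K g hv

theorem Representation.mem_fixedBy {K : Subgroup G} [K.Normal] {v : V} :
    v ∈ (ρ.fixedBy K).toSubmodule ↔ ∀ n ∈ K, ρ n v = v :=
  ⟨fun h n hn => h ⟨n, hn⟩, fun h n => h n n.2⟩

theorem Representation.trivial_of_trivial_on_atoms [Finite G] [FiniteDimensional ℂ V]
    (K : Subgroup G) [K.Normal]
    (h : ∀ τ : Subrepresentation ρ, IsAtom τ → ∀ n ∈ K, τ.toRepresentation n = 1) :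
    ∀ n ∈ K, ρ n = 1 := by
  have htop : ρ.fixedBy K = ⊤ := by
    obtain ⟨γ, hγ⟩ := exists_isCompl (ρ.fixedBy K)
    by_cases h0 : γ = ⊥
    · have := hγ.sup_eq_top
      rwa [h0, sup_bot_eq] at this
    obtain ⟨τ, hτγ, hτ⟩ := γ.exists_atom_le h0
    refine absurd (le_bot_iff.1 (hγ.inf_eq_bot ▸ le_inf ?_ hτγ)) hτ.1
    intro v hv
    refine mem_fixedBy.2 fun n hn => ?_
    exact congrArg Subtype.val (LinearMap.congr_fun (h τ hτ n hn) ⟨v, hv⟩)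
  intro n hn
  ext v
  refine (mem_fixedBy (K := K)).1 ?_ n hn
  rw [htop]; exact Submodule.mem_top

theorem Representation.IsIrreducible.trivial_of_fixed [ρ.IsIrreducible]
    (K : Subgroup G) [K.Normal] {v : V} (hv : v ≠ 0) (h : ∀ n ∈ K, ρ n v = v) :
    ∀ n ∈ K, ρ n = 1 := by
  have hmem : v ∈ (ρ.fixedBy K).toSubmodule := mem_fixedBy.2 h
  rcases eq_bot_or_eq_top (ρ.fixedBy K) with h0 | h0
  · rw [h0] at hmem
    exact absurd ((Submodule.mem_bot ℂ).1 hmem) hv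
  · intro n hn
    ext w
    refine (mem_fixedBy (K := K)).1 ?_ n hn
    rw [h0]; exact Submodule.mem_top

end Subreps

section Monomial

/-- A vector spanning a line stable under `H` bounds the dimension of an irreducible
representation by the index of `H`. -/
theorem Representation.IsIrreducible.finrank_le_index {G : Type} [Group G] [Finite G]
    {V : Type} [AddCommGroup V] [Module ℂ V] {ρ : Representation ℂ G V} [ρ.IsIrreducible]
    {H : Subgroup G} {v : V} (hv : v ≠ 0)
    (h : ∀ x ∈ H, ∃ c : ℂ, ρ x v = c • v) : finrank ℂ V ≤ H.index := by
  have := Fintype.ofFinite (G ⧸ H)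
  let S : Subrepresentation ρ :=
    ⟨Submodule.span ℂ (Set.range fun q : G ⧸ H => ρ q.out v), by
      intro g w hw
      induction hw using Submodule.span_induction with
      | mem x hx =>
        obtain ⟨q, rfl⟩ := hx
        have h1 : ((g * q.out : G) : G ⧸ H) = ((g * q.out : G) : G ⧸ H).out := by simp
        obtain ⟨c, hc⟩ := h _ (QuotientGroup.eq.1 h1.symm)
        have h2 : ρ g (ρ q.out v) = c • ρ ((g * q.out : G) : G ⧸ H).out v := by
          rw [← map_smul, ← hc, ← Module.End.mul_apply, ← Module.End.mul_apply, ← map_mul,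
            ← map_mul]
          simp
        change ρ g (ρ q.out v) ∈ _
        rw [h2]
        exact Submodule.smul_mem _ _ (Submodule.subset_span ⟨_, rfl⟩)
      | zero => simp
      | add x y _ _ hx hy => rw [map_add]; exact Submodule.add_mem _ hx hy
      | smul a x _ hx => rw [map_smul]; exact Submodule.smul_mem _ a hx⟩
  have hS : S = ⊤ := by
    refine (eq_bot_or_eq_top S).resolve_left fun h0 => ?_
    have h1 : ρ ((1 : G) : G ⧸ H).out v ∈ S.toSubmodule := Submodule.subset_span ⟨_, rfl⟩
    rw [h0] at h1
    have h2 : ρ ((1 : G) : G ⧸ H).out v = 0 := (Submodule.mem_bot ℂ).1 h1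
    have h3 := congrArg (ρ ((1 : G) : G ⧸ H).out⁻¹) h2
    rw [map_zero, ← Module.End.mul_apply, ← map_mul] at h3
    simp at h3
    exact hv h3
  have h1 : finrank ℂ S.toSubmodule ≤ Fintype.card (G ⧸ H) := finrank_range_le_card _
  rw [hS] at h1
  have h2 : finrank ℂ (⊤ : Subrepresentation ρ).toSubmodule = finrank ℂ V := finrank_top ℂ V
  rw [Subgroup.index, Nat.card_eq_fintype_card]
  omega

theorem Representation.IsIrreducible.exists_eq_smul_one {G : Type} [Group G] {V : Type}
    [AddCommGroup V] [Module ℂ V] [FiniteDimensional ℂ V] {ρ : Representation ℂ G V}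
    [ρ.IsIrreducible] (T : V →ₗ[ℂ] V) (hT : ∀ g, Commute T (ρ g)) : ∃ c : ℂ, T = c • 1 := by
  obtain ⟨c, hc⟩ := (IsIrreducible.algebraMap_intertwiningMap_bijective_of_isAlgClosed
    (ρ := ρ)).2 ⟨T, fun g => hT g⟩
  refine ⟨c, ?_⟩
  have := congrArg IntertwiningMap.toLinearMap hc
  rw [Algebra.algebraMap_eq_smul_one] at this
  exact this.symm

theorem card_mul_finrank_le {ι K V : Type} [Field K] [Fintype ι] [AddCommGroup V] [Module K V]
    [FiniteDimensional K V] (W : ι → Submodule K V) (h : iSupIndep W) (d : ℕ)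
    (hd : ∀ i, finrank K (W i) = d) : Fintype.card ι * d ≤ finrank K V := by
  classical
  have h1 := LinearMap.finrank_le_finrank_of_injective h.dfinsupp_lsum_injective
  have h2 : finrank K (DirectSum ι fun i => W i) = ∑ i, finrank K (W i) :=
    Module.finrank_directSum K fun i => W i
  simp only [hd, Finset.sum_const, Finset.card_univ, smul_eq_mul] at h2
  rw [← h2]
  exact h1

/-- In a nilpotent group, an irreducible representation has a vector spanning a line stable
under a subgroup of index at most the dimension. -/
theorem Representation.IsIrreducible.exists_index_le_finrank {G : Type} [Group G] [Finite G]
    [Group.IsNilpotent G] {V : Type} [AddCommGroup V] [Module ℂ V] [FiniteDimensional ℂ V]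
    (ρ : Representation ℂ G V) [ρ.IsIrreducible] :
    ∃ (H : Subgroup G) (v : V), v ≠ 0 ∧ (∀ x ∈ H, ∃ c : ℂ, ρ x v = c • v) ∧
      H.index ≤ finrank ℂ V := by
  induction hn : Nat.card G using Nat.strong_induction_on generalizing G V with
  | _ n ih =>
    have hV : Nontrivial V := IsIrreducible.nontrivial (ρ := ρ)
    let Z : Subgroup G :=
      { carrier := {z | ∀ g, Commute (ρ z) (ρ g)}
        one_mem' := fun g => by rw [map_one]; exact Commute.one_left _
        mul_mem' := fun ha hb g => by rw [map_mul]; exact (ha g).mul_left (hb g)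
        inv_mem' := fun {z} hz g => by
          have h := congrArg (fun t => ρ z⁻¹ * t * ρ z⁻¹) (hz g).eq
          simp only [← map_mul] at h
          rw [Commute, SemiconjBy, ← map_mul, ← map_mul]
          simpa [mul_assoc] using h.symm }
    have hscalar : ∀ z ∈ Z, ∃ c : ℂ, ρ z = c • 1 := fun z hz =>
      IsIrreducible.exists_eq_smul_one (ρ := ρ) _ hz
    have hZn : Z.Normal := ⟨fun z hz g => by
      obtain ⟨c, hc⟩ := hscalar z hz
      have : ρ (g * z * g⁻¹) = c • 1 := by
        rw [map_mul, map_mul, hc, mul_smul_comm, mul_one, smul_mul_assoc, ← map_mul]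
        simp
      intro k
      rw [this]
      exact (Commute.one_left _).smul_left c⟩
    by_cases hZ : Z = ⊤
    · obtain ⟨v, hv⟩ := exists_ne (0 : V)
      refine ⟨⊤, v, hv, fun x _ => ?_, ?_⟩
      · obtain ⟨c, hc⟩ := hscalar x (hZ ▸ Subgroup.mem_top x)
        exact ⟨c, by rw [hc]; rfl⟩
      · rw [Subgroup.index_top]; exact finrank_pos
    have hnt : Nontrivial (G ⧸ Z) := QuotientGroup.nontrivial_iff.2 hZ
    obtain ⟨q, hq, hq1⟩ := (Subgroup.bot_or_exists_ne_one _).resolve_left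
      (Group.IsNilpotent.center_ne_bot (G := G ⧸ Z))
    obtain ⟨a, haq⟩ := QuotientGroup.mk_surjective q
    have haZ : a ∉ Z := fun h => hq1 (haq ▸ (QuotientGroup.eq_one_iff a).2 h)
    have hcomm : ∀ g, ∃ c : ℂ, ρ a * ρ g = c • (ρ g * ρ a) := fun g => by
      have h1 : (g * a)⁻¹ * (a * g) ∈ Z := by
        rw [← QuotientGroup.eq, QuotientGroup.mk_mul, QuotientGroup.mk_mul, haq]
        exact (Subgroup.mem_center_iff.1 hq g)
      obtain ⟨c, hc⟩ := hscalar _ h1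
      refine ⟨c, ?_⟩
      rw [← map_mul, ← map_mul, ← mul_inv_cancel_left (g * a) (a * g), map_mul, hc]
      simp
    choose ζ hζ using hcomm
    have hne : ∀ g, ρ g ≠ 0 := fun g h => by
      have : ρ (g * g⁻¹) = 0 := by rw [map_mul, h, zero_mul]
      rw [mul_inv_cancel, map_one] at this
      exact one_ne_zero this
    have hζ0 : ∀ g, ζ g ≠ 0 := fun g h => by
      have := hζ g
      rw [h, zero_smul, ← map_mul] at this
      exact hne _ this
    let T : Subgroup G :=
      { carrier := {g | Commute (ρ g) (ρ a)}
        one_mem' := by simp [map_one]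
        mul_mem' := fun ha hb => by
          simp only [Set.mem_ofPred_eq] at *; rw [map_mul]; exact ha.mul_left hb
        inv_mem' := fun {z} hz => by
          have h := congrArg (fun t => ρ z⁻¹ * t * ρ z⁻¹) hz.eq
          simp only [← map_mul] at h
          rw [Set.mem_ofPred_eq, Commute, SemiconjBy, ← map_mul, ← map_mul]
          simpa [mul_assoc] using h.symm }
    have hT : T ≠ ⊤ := fun h => haZ fun g => ((h ▸ Subgroup.mem_top g : g ∈ T) : Commute _ _).symm
    have hζT : ∀ g h, ζ g = ζ h → g⁻¹ * h ∈ T := fun g h hgh => by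
      have h1 : ρ g⁻¹ * ρ a = ζ g • (ρ a * ρ g⁻¹) := by
        have := congrArg (fun t => ρ g⁻¹ * t * ρ g⁻¹) (hζ g)
        simp only [mul_smul_comm, smul_mul_assoc, ← map_mul] at this
        simpa [mul_assoc] using this
      have h2 : ζ g • (ρ (g⁻¹ * h) * ρ a) = ζ g • (ρ a * ρ (g⁻¹ * h)) := by
        rw [map_mul, mul_assoc, ← mul_smul_comm, hgh, ← hζ h, ← mul_assoc, h1, smul_mul_assoc,
          mul_assoc, hgh]
      exact smul_right_injective _ (hζ0 g) h2
    obtain ⟨c, hc⟩ := Module.End.exists_eigenvalue (ρ a)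
    have hc0 : c ≠ 0 := by
      rintro rfl
      obtain ⟨v, hv⟩ := hc.exists_hasEigenvector
      have h1 := hv.apply_eq_smul
      rw [zero_smul] at h1
      have h2 := congrArg (ρ a⁻¹) h1
      rw [map_zero, ← Module.End.mul_apply, ← map_mul] at h2
      simp at h2
      exact hv.2 h2
    let E := Module.End.eigenspace (ρ a)
    have : Fintype (G ⧸ T) := Fintype.ofFinite _
    let W : G ⧸ T → Submodule ℂ V := fun q => (E c).map (ρ q.out)
    have hW : ∀ q, W q ≤ E (ζ q.out * c) := by
      rintro q _ ⟨w, hw, rfl⟩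
      have hw' : ρ a w = c • w := Module.End.mem_eigenspace_iff.1 hw
      refine Module.End.mem_eigenspace_iff.2 ?_
      rw [← Module.End.mul_apply, hζ, LinearMap.smul_apply, Module.End.mul_apply, hw', map_smul,
        smul_smul]
    have hinj : Function.Injective fun q : G ⧸ T => ζ q.out * c := fun q r hqr => by
      have h1 := hζT _ _ (mul_right_cancel₀ hc0 hqr)
      rw [← QuotientGroup.eq] at h1
      simpa using h1
    have hind : iSupIndep W :=
      ((Module.End.eigenspaces_iSupIndep (ρ a)).comp hinj).mono hW
    have hdim : ∀ q, finrank ℂ (W q) = finrank ℂ (E c) := fun q =>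
      (Submodule.equivMapOfInjective _ (fun x y hxy => by
        simpa [← Module.End.mul_apply, ← map_mul] using congrArg (ρ q.out⁻¹) hxy) _).finrank_eq.symm
    have hle := card_mul_finrank_le W hind _ hdim
    let σ : Subrepresentation (ρ.comp T.subtype) :=
      ⟨E c, fun g v hv => by
        have hv' : ρ a v = c • v := Module.End.mem_eigenspace_iff.1 hv
        refine Module.End.mem_eigenspace_iff.2 ?_
        have : Commute (ρ g) (ρ a) := g.2
        change ρ a (ρ g v) = c • ρ g v
        rw [← Module.End.mul_apply, ← this.eq, Module.End.mul_apply, hv', map_smul]⟩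
    have hσ : σ ≠ ⊥ := fun h => hc (congrArg Subrepresentation.toSubmodule h)
    obtain ⟨τ, hτσ, hτ⟩ := σ.exists_atom_le hσ
    have hirr := Subrepresentation.isIrreducible_of_isAtom hτ
    have hcard : Nat.card T < n := by
      rw [← hn]
      exact lt_of_le_of_ne T.card_le_card_group (mt T.eq_top_of_card_eq hT)
    obtain ⟨H, v, hv0, hv, hH⟩ := ih _ hcard τ.toRepresentation rfl
    refine ⟨H.map T.subtype, v, fun h => hv0 (Subtype.ext h), ?_, ?_⟩
    · rintro _ ⟨x, hx, rfl⟩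
      obtain ⟨d, hd⟩ := hv x hx
      exact ⟨d, congrArg Subtype.val hd⟩
    · rw [Subgroup.index_map_subtype, mul_comm]
      refine le_trans ?_ hle
      rw [Subgroup.index, Nat.card_eq_fintype_card]
      exact Nat.mul_le_mul_left _ (hH.trans (Submodule.finrank_mono hτσ))

theorem Representation.IsIrreducible.exists_index_eq_finrank {G : Type} [Group G] [Finite G]
    [Group.IsNilpotent G] {V : Type} [AddCommGroup V] [Module ℂ V] [FiniteDimensional ℂ V]
    (ρ : Representation ℂ G V) [ρ.IsIrreducible] :
    ∃ (H : Subgroup G) (v : V), v ≠ 0 ∧ (∀ x ∈ H, ∃ c : ℂ, ρ x v = c • v) ∧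
      H.index = finrank ℂ V := by
  obtain ⟨H, v, hv, h, hH⟩ := IsIrreducible.exists_index_le_finrank ρ
  exact ⟨H, v, hv, h, hH.antisymm (finrank_le_index hv h)⟩

/-- The permutation representation on functions. -/
def Representation.functions (G X W : Type) [Group G] [MulAction G X] [AddCommGroup W]
    [Module ℂ W] : Representation ℂ G (X → W) where
  toFun g := LinearMap.funLeft ℂ W (g⁻¹ • ·)
  map_one' := by ext; simp [LinearMap.funLeft_apply]
  map_mul' g h := by ext; simp [LinearMap.funLeft_apply, mul_smul]

theorem Representation.functions_apply {G X W : Type} [Group G] [MulAction G X] [AddCommGroup W]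
    [Module ℂ W] (g : G) (f : X → W) (x : X) : functions G X W g f x = f (g⁻¹ • x) := rfl

theorem Representation.smul_eq_of_functions_eq_one {G X : Type} [Group G] [MulAction G X]
    {g : G} (h : functions G X ℂ g = 1) (x : X) : g • x = x := by
  classical
  have h1 := congrFun (LinearMap.congr_fun h (Pi.single x 1)) (g • x)
  rw [functions_apply, inv_smul_smul, Pi.single_eq_same] at h1
  by_contra hne
  simp [Pi.single_eq_of_ne hne] at h1

theorem Representation.finrank_lt_of_isAtom_functions {G X : Type} [Group G] [MulAction G X]
    [Finite X] (hX : 1 < Nat.card X) (τ : Subrepresentation (functions G X ℂ))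
    (hτ : IsAtom τ) : finrank ℂ τ.toSubmodule < Nat.card X := by
  have := Fintype.ofFinite X
  have hfr : finrank ℂ (X → ℂ) = Nat.card X := by simp
  refine lt_of_le_of_ne (hfr ▸ Submodule.finrank_le _) fun h => ?_
  have htop : τ = ⊤ := Subrepresentation.toSubmodule_injective
    (Submodule.eq_top_of_finrank_eq (h.trans hfr.symm))
  let σ : Subrepresentation (functions G X ℂ) :=
    ⟨ℂ ∙ (fun _ => 1), fun g v hv => by
      obtain ⟨c, rfl⟩ := Submodule.mem_span_singleton.1 hv
      exact Submodule.mem_span_singleton.2 ⟨c, rfl⟩⟩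
  have hσ : σ ≠ ⊥ := fun h => by
    have h1 : (fun _ => 1 : X → ℂ) ∈ σ.toSubmodule := Submodule.mem_span_singleton_self _
    rw [h] at h1
    have hne : Nonempty X := (Nat.card_pos_iff.1 (by omega)).1
    exact one_ne_zero (congrFun ((Submodule.mem_bot ℂ).1 h1) hne.some)
  have h2 : σ = τ := (hτ.le_iff.1 (htop ▸ le_top)).resolve_left hσ
  have h3 : finrank ℂ σ.toSubmodule ≤ 1 := by
    simpa using finrank_span_le_card (R := ℂ) ({fun _ => 1} : Set (X → ℂ))
  rw [h2] at h3
  omega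

theorem Representation.IsIrreducible.commutator_trivial {G : Type} [Group G] [Finite G]
    [Group.IsNilpotent G] {V : Type} [AddCommGroup V] [Module ℂ V] [FiniteDimensional ℂ V]
    (ρ : Representation ℂ G V) [ρ.IsIrreducible] (K : Subgroup G) [K.Normal]
    (hK : ∀ (W : Type) [AddCommGroup W] [Module ℂ W] [FiniteDimensional ℂ W]
      (σ : Representation ℂ G W) [σ.IsIrreducible], finrank ℂ W < finrank ℂ V →
      ∀ n ∈ K, σ n = 1) : ∀ n ∈ ⁅K, K⁆, ρ n = 1 := by
  obtain ⟨H, v, hv, hvH, hH⟩ := IsIrreducible.exists_index_eq_finrank ρ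
  have hKH : K ≤ H := by
    by_cases h1 : H.index = 1
    · rw [Subgroup.index_eq_one.1 h1]; exact le_top
    have h2 : 1 < Nat.card (G ⧸ H) := by
      have : H.index ≠ 0 := Subgroup.index_ne_zero_of_finite
      rw [← Subgroup.index]; omega
    have h3 := trivial_of_trivial_on_atoms (ρ := functions G (G ⧸ H) ℂ) K fun τ hτ => by
      have := Subrepresentation.isIrreducible_of_isAtom hτ
      refine hK _ τ.toRepresentation ?_
      rw [← hH]
      exact finrank_lt_of_isAtom_functions h2 τ hτ
    intro n hn
    have h4 := smul_eq_of_functions_eq_one (h3 n hn) ((1 : G) : G ⧸ H)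
    rw [MulAction.Quotient.smul_coe, eq_comm, QuotientGroup.eq] at h4
    simpa using h4
  refine trivial_of_fixed ⁅K, K⁆ hv ?_
  let F : Subgroup G :=
    { carrier := {x | ρ x v = v}
      one_mem' := by simp
      mul_mem' := fun {x y} hx hy => by
        simp only [Set.mem_ofPred_eq] at *
        rw [map_mul, Module.End.mul_apply, hy, hx]
      inv_mem' := fun {x} hx => by
        simp only [Set.mem_ofPred_eq] at *
        nth_rw 1 [← hx]
        rw [← Module.End.mul_apply, ← map_mul]
        simp }
  suffices h : ⁅K, K⁆ ≤ F from h
  refine Subgroup.commutator_le.2 fun x hx y hy => ?_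
  obtain ⟨c, hc⟩ := hvH x⁻¹ (hKH (inv_mem hx))
  obtain ⟨d, hd⟩ := hvH y⁻¹ (hKH (inv_mem hy))
  have h1 : ρ (x⁻¹ * y⁻¹) v = ρ (y⁻¹ * x⁻¹) v := by
    simp [hc, hd, smul_smul, mul_comm]
  have h2 : x * y * x⁻¹ * y⁻¹ = (y⁻¹ * x⁻¹)⁻¹ * (x⁻¹ * y⁻¹) := by
    simp [mul_assoc]
  change ρ (x * y * x⁻¹ * y⁻¹) v = v
  rw [h2, map_mul, Module.End.mul_apply, h1, ← Module.End.mul_apply, ← map_mul, inv_mul_cancel,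
    map_one, Module.End.one_apply]

end Monomial

section Coinduced

variable {G : Type} [Group G] {W : Type} [AddCommGroup W] [Module ℂ W]

/-- The coinduced representation, as a subrepresentation of all functions `G → W`. -/
def Representation.coinduced (P : Subgroup G) (σ : Representation ℂ P W) :
    Subrepresentation (functions G G W) where
  toSubmodule :=
    { carrier := {f | ∀ (g : G) (x : P), f (g * x) = σ x⁻¹ (f g)}
      add_mem' := fun ha hb g x => by simp [ha g x, hb g x]
      zero_mem' := fun g x => by simp
      smul_mem' := fun c f hf g x => by simp [hf g x] }
  apply_mem_toSubmodule g f hf h x := by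
    simp only [functions_apply, smul_eq_mul, ← mul_assoc]
    exact hf _ _

/-- A coinduced function is determined by its values on coset representatives. -/
noncomputable def Representation.coinducedEquiv (P : Subgroup G) (σ : Representation ℂ P W) :
    (coinduced P σ).toSubmodule ≃ₗ[ℂ] (G ⧸ P → W) :=
  let part : G → P := fun g => ⟨(g : G ⧸ P).out⁻¹ * g, QuotientGroup.eq.1 (by simp)⟩
  have hpart : ∀ (g : G) (x : P), part (g * x) = part g * x := fun g x => by
    exact Subtype.ext (by simp [part, mul_assoc])
  have hout : ∀ q : G ⧸ P, part q.out = 1 := fun q => by simp [part]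
  { toFun := fun f q => f.1 q.out
    map_add' := fun _ _ => rfl
    map_smul' := fun _ _ => rfl
    invFun := fun h => ⟨fun g => σ (part g)⁻¹ (h g), fun g x => by
      simp [hpart]⟩
    left_inv := fun f => by
      ext g
      change σ (part g)⁻¹ (f.1 (g : G ⧸ P).out) = f.1 g
      rw [← f.2]
      simp [part]
    right_inv := fun h => by
      ext q
      change σ (part q.out)⁻¹ (h (q.out : G ⧸ P)) = h q
      simp [hout] }

theorem Representation.finrank_coinduced [Finite G] [FiniteDimensional ℂ W] (P : Subgroup G)
    (σ : Representation ℂ P W) :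
    finrank ℂ (coinduced P σ).toSubmodule = P.index * finrank ℂ W := by
  have := Fintype.ofFinite (G ⧸ P)
  rw [(coinducedEquiv P σ).finrank_eq, Module.finrank_pi_fintype, Subgroup.index,
    Nat.card_eq_fintype_card]
  simp

theorem Representation.IsIrreducible.exists_irreducible_above [Finite G] [FiniteDimensional ℂ W]
    (p : ℕ) [Fact p.Prime] (P : Subgroup G) (σ : Representation ℂ P W) [σ.IsIrreducible] :
    ∃ τ : Subrepresentation (functions G G W), IsAtom τ ∧
      padicValNat p (finrank ℂ τ.toSubmodule) ≤ padicValNat p (P.index * finrank ℂ W) ∧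
      ∀ K : Subgroup P, K.Normal → (∀ n ∈ K, τ.toRepresentation n = 1) → ∀ n ∈ K, σ n = 1 := by
  have : Nontrivial W := IsIrreducible.nontrivial (ρ := σ)
  have hne : coinduced P σ ≠ ⊥ := fun h => by
    have h1 := finrank_coinduced P σ
    have h2 : finrank ℂ (⊥ : Subrepresentation (functions G G W)).toSubmodule = 0 :=
      finrank_bot ℂ (G → W)
    rw [h, h2, eq_comm, Nat.mul_eq_zero] at h1
    exact h1.elim Subgroup.index_ne_zero_of_finite finrank_pos.ne'
  obtain ⟨τ, hle, hτ, hval⟩ := (coinduced P σ).exists_atom_padicValNat_le p hne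
  refine ⟨τ, hτ, finrank_coinduced P σ ▸ hval, fun K hK h => ?_⟩
  obtain ⟨f, hf, hf0⟩ := (Submodule.ne_bot_iff _).1 fun h0 : τ.toSubmodule = ⊥ =>
    hτ.1 (Subrepresentation.toSubmodule_injective h0)
  obtain ⟨g, hg⟩ := Function.ne_iff.1 hf0
  have hf' := τ.apply_mem_toSubmodule g⁻¹ hf
  have hval1 : functions G G W g⁻¹ f 1 = f g := by simp [functions_apply]
  refine IsIrreducible.trivial_of_fixed (ρ := σ) K hg fun n hn => ?_
  have h1 := congrFun (congrArg Subtype.val (LinearMap.congr_fun (h n hn) ⟨_, hf'⟩)) 1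
  change functions G G W n (functions G G W g⁻¹ f) 1 = functions G G W g⁻¹ f 1 at h1
  have h2 := hle hf' 1 n⁻¹
  rw [functions_apply, smul_eq_mul, mul_one] at h1
  rw [one_mul, inv_inv, hval1, InvMemClass.coe_inv, h1, hval1] at h2
  exact h2.symm

end Coinduced

section Derived

variable {G : Type} [Group G]

/-- The derived series of a subgroup, inside the ambient group. -/
def Subgroup.derivedSeriesIn (N : Subgroup G) (i : ℕ) : Subgroup G :=
  (derivedSeries N i).map N.subtype

theorem Subgroup.derivedSeriesIn_zero (N : Subgroup G) : N.derivedSeriesIn 0 = N := by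
  rw [derivedSeriesIn, derivedSeries_zero, ← MonoidHom.range_eq_map, N.range_subtype]

theorem Subgroup.derivedSeriesIn_succ (N : Subgroup G) (i : ℕ) :
    N.derivedSeriesIn (i + 1) = ⁅N.derivedSeriesIn i, N.derivedSeriesIn i⁆ := by
  rw [derivedSeriesIn, derivedSeries_succ, map_commutator]; rfl

instance Subgroup.derivedSeriesIn_normal (N : Subgroup G) [N.Normal] (i : ℕ) :
    (N.derivedSeriesIn i).Normal := by
  induction i with
  | zero => rw [derivedSeriesIn_zero]; infer_instance
  | succ i ih => rw [derivedSeriesIn_succ]; infer_instance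

theorem Subgroup.derivedSeriesIn_antitone (N : Subgroup G) : Antitone N.derivedSeriesIn :=
  fun _ _ h => Subgroup.map_mono (derivedSeries_antitone N h)

theorem Subgroup.derivedSeriesIn_le (N : Subgroup G) (i : ℕ) : N.derivedSeriesIn i ≤ N :=
  N.map_subtype_le _

theorem derivedSeriesIn_trivial [Finite G] (p : ℕ) [Fact p.Prime] (P : Sylow p G)
    (N : Subgroup G) [N.Normal] (hNP : N ≤ P) (S : Set ℕ) (hSf : S.Finite)
    (hS : ∀ (V : Type) [AddCommGroup V] [Module ℂ V] [FiniteDimensional ℂ V]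
      (ρ : Representation ℂ G V) [ρ.IsIrreducible], ∀ n ∈ N, ρ n ≠ 1 →
      p ^ padicValNat p (finrank ℂ V) ∈ S) (x : ℕ)
    (V : Type) [AddCommGroup V] [Module ℂ V] [FiniteDimensional ℂ V]
    (ρ : Representation ℂ G V) [ρ.IsIrreducible] (hx : p ^ padicValNat p (finrank ℂ V) ≤ x) :
    ∀ n ∈ N.derivedSeriesIn (S ∩ Set.Iic x).ncard, ρ n = 1 := by
  induction x using Nat.strong_induction_on generalizing V with
  | _ x ih =>
    by_cases htriv : ∀ n ∈ N, ρ n = 1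
    · exact fun n hn => htriv n (N.derivedSeriesIn_le _ hn)
    push Not at htriv
    obtain ⟨m, hm, hmρ⟩ := htriv
    have : Nontrivial V := IsIrreducible.nontrivial (ρ := ρ)
    have hPnil : Group.IsNilpotent P := P.2.isNilpotent
    set y := p ^ padicValNat p (finrank ℂ V) with hy
    have hyS : y ∈ S := hS V ρ m hm hmρ
    have hypos : 0 < y := pow_pos (Fact.out : p.Prime).pos _
    have hr : (S ∩ Set.Iic (y - 1)).ncard + 1 ≤ (S ∩ Set.Iic x).ncard := by
      rw [← Set.ncard_insert_of_notMem (a := y) (by simp; omega)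
        (hSf.subset Set.inter_subset_left)]
      refine Set.ncard_le_ncard ?_ (hSf.subset Set.inter_subset_left)
      rintro z (rfl | ⟨hz, hz1⟩)
      · exact ⟨hyS, hx⟩
      · exact ⟨hz, by simp at hz1 ⊢; omega⟩
    set r := (S ∩ Set.Iic (y - 1)).ncard
    obtain ⟨μ, -, hμ, hμv⟩ := Subrepresentation.exists_atom_padicValNat_le p
      (⊤ : Subrepresentation (ρ.comp (P : Subgroup G).subtype)) Subrepresentation.top_ne_bot
    have hμi := Subrepresentation.isIrreducible_of_isAtom hμ
    have hμy : finrank ℂ μ.toSubmodule ≤ y := by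
      obtain ⟨H, -, -, -, hH⟩ := IsIrreducible.exists_index_eq_finrank μ.toRepresentation
      obtain ⟨k, hk⟩ := P.2.index H
      have h0 : finrank ℂ (⊤ : Subrepresentation (ρ.comp (P : Subgroup G).subtype)).toSubmodule =
        finrank ℂ V := finrank_top ℂ V
      rw [h0, ← hH, hk, padicValNat.prime_pow] at hμv
      rw [← hH, hk]
      exact Nat.pow_le_pow_right (Fact.out : p.Prime).pos hμv
    let K : Subgroup P := (N.derivedSeriesIn r).subgroupOf P
    have hKmem : ∀ n ∈ N.derivedSeriesIn (r + 1), ∃ k ∈ ⁅K, K⁆, (k : G) = n := by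
      have h1 : K.map (P : Subgroup G).subtype = N.derivedSeriesIn r :=
        Subgroup.map_subgroupOf_eq_of_le ((N.derivedSeriesIn_le r).trans hNP)
      intro n hn
      rw [Subgroup.derivedSeriesIn_succ, ← h1, ← Subgroup.map_commutator] at hn
      exact hn
    have hcomm := IsIrreducible.commutator_trivial μ.toRepresentation K fun W _ _ _ σ _ hlt => by
      have : Nontrivial W := IsIrreducible.nontrivial (ρ := σ)
      obtain ⟨τ, hτ, hτv, hτK⟩ := IsIrreducible.exists_irreducible_above p (P : Subgroup G) σ
      have hτi := Subrepresentation.isIrreducible_of_isAtom hτ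
      rw [padicValNat.mul Subgroup.index_ne_zero_of_finite finrank_pos.ne',
        padicValNat.eq_zero_of_not_dvd P.not_dvd_index, zero_add] at hτv
      have h1 : p ^ padicValNat p (finrank ℂ τ.toSubmodule) ≤ y - 1 := by
        have h2 := Nat.pow_le_pow_right (Fact.out : p.Prime).pos hτv
        have h3 := Nat.le_of_dvd finrank_pos (pow_padicValNat_dvd (p := p) (n := finrank ℂ W))
        omega
      exact hτK K inferInstance fun n hn =>
        ih (y - 1) (by omega) _ τ.toRepresentation h1 n hn
    obtain ⟨v, hv, hv0⟩ := (Submodule.ne_bot_iff _).1 fun h0 : μ.toSubmodule = ⊥ =>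
      hμ.1 (Subrepresentation.toSubmodule_injective h0)
    intro n hn
    refine IsIrreducible.trivial_of_fixed (ρ := ρ) (N.derivedSeriesIn (r + 1)) hv0
      (fun n hn => ?_) n (N.derivedSeriesIn_antitone hr hn)
    obtain ⟨k, hk, rfl⟩ := hKmem n hn
    exact congrArg Subtype.val (LinearMap.congr_fun (hcomm k hk) ⟨v, hv⟩)

theorem derivedSeries_eq_bot_of_isPGroup [Finite G] (p : ℕ) [Fact p.Prime] (N : Subgroup G)
    [N.Normal] (hN : IsPGroup p N) (k : ℕ) (hk : (cdOver G N).ncard ≤ k) :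
    derivedSeries N k = ⊥ := by
  obtain ⟨P, hP⟩ := hN.exists_le_sylow
  let S : Set ℕ := (fun d => p ^ padicValNat p d) '' cdOver G N
  have hSf : S.Finite := (cdOver_finite N).image _
  have hSk : S.ncard ≤ k := (Set.ncard_image_le (cdOver_finite N)).trans hk
  have h1 := trivial_of_trivial_on_atoms (ρ := functions G G ℂ) (N.derivedSeriesIn k)
    fun τ hτ n hn => by
      have := Subrepresentation.isIrreducible_of_isAtom hτ
      refine derivedSeriesIn_trivial p P N hP S hSf
        (fun V _ _ _ ρ _ m hm h => ⟨_, finrank_mem_cdOver ρ hm h, rfl⟩) _ _ τ.toRepresentation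
        le_rfl n (N.derivedSeriesIn_antitone ?_ hn)
      exact (Set.ncard_le_ncard Set.inter_subset_left hSf).trans hSk
  refine (Subgroup.eq_bot_iff_forall _).2 fun n hn => Subtype.ext ?_
  have h2 := smul_eq_of_functions_eq_one (h1 n ⟨n, hn, rfl⟩) (1 : G)
  simpa using h2

end Derived

end DegreeBound

/-- **Corollary 3.3.** If `N ⊴ G` is nilpotent, then the derived length of `N` is at
most `|cd(G|N)|`. -/
theorem stmt3 (G : Type) [Group G] [Fintype G] (N : Subgroup G) [N.Normal]
    (hnil : Group.IsNilpotent ↥N) :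
    derivedSeries ↥N ((cdOver G N).ncard) = ⊥ := by
  set k := (cdOver G N).ncard with hk
  obtain ⟨e⟩ := (Group.isNilpotent_of_finite_tfae (G := N)).out 0 4 |>.1 hnil
  refine (Subgroup.eq_bot_iff_forall _).2 fun x hx => ?_
  rw [← map_eq_one_iff e.symm e.symm.injective]
  refine funext fun p => funext fun Q => ?_
  have : Fact (p : ℕ).Prime := ⟨Nat.prime_of_mem_primeFactors p.2⟩
  let π : N →* Q := (Pi.evalMonoidHom _ Q).comp ((Pi.evalMonoidHom _ p).comp e.symm.toMonoidHom)
  have hQ : derivedSeries Q k = ⊥ := by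
    let M : Subgroup G := (Q : Subgroup N).map N.subtype
    let f : Q ≃* M := (Q : Subgroup N).equivMapOfInjective N.subtype N.subtype_injective
    have : (Q : Subgroup N).Characteristic := Sylow.characteristic_of_normal Q inferInstance
    have hM : M.Normal := inferInstance
    have h1 := derivedSeries_eq_bot_of_isPGroup p M (Q.2.of_equiv f) k
      (Set.ncard_le_ncard (cdOver_mono (N.map_subtype_le _)) (cdOver_finite N))
    have h2 := map_derivedSeries_le_derivedSeries f.toMonoidHom k
    rw [h1, le_bot_iff] at h2
    exact (Subgroup.map_eq_bot_iff_of_injective _ f.injective).1 h2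
  have h1 : π x ∈ derivedSeries Q k :=
    map_derivedSeries_le_derivedSeries π k ⟨x, hx, rfl⟩
  rw [hQ, Subgroup.mem_bot] at h1
  exact h1
end
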